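/- Variant of the comparison principle on (0,∞): Let ū be a super-solution and u̲ a sub-solution of (⋆) on (0,∞) such that: 0 ≤ ū, u̲ ≤ s_+ on (0,∞); ū(r) = ᾱ·r^{γ_+} + o(r^{γ_+}) and u̲(r) = α̲·r^{γ_+} + o(r^{γ_+}) as r → 0, with ᾱ > 0; ū(r) = s_+ − β̄·r^{−2} + o(r^{−2}) as r → ∞; and limsup_{r→∞} u̲(r) < s_+. Then ū(r) ≥ u̲(r) for all r ∈ (0,∞); moreover, if ū(r₀) = u̲(r₀) for some r₀ ∈ (0,∞), then ū ≡ u̲ on (0,∞). -/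

import Mathlib

open Set Filter Topology MeasureTheory
open scoped ENNReal NNReal

/-- `γ₊ = ((1-p) + √((p-1)² + 4q))/2`, the positive root of `γ² + (p-1)γ - q = 0`. -/
noncomputable def gammaPlus (p q : ℝ) : ℝ :=
  ((1 - p) + Real.sqrt ((p - 1) ^ 2 + 4 * q)) / 2

/-- Condition (condF) on the nonlinearity `F` (with `0 < sp` recorded separately). -/
def CondF (F : ℝ → ℝ) (sp : ℝ) : Prop :=
  ContDiff ℝ 1 F ∧ F 0 = 0 ∧ F sp = 0 ∧
    (∀ t ∈ Set.Ioo 0 sp, F t < 0) ∧ (∀ t, sp < t → 0 < F t) ∧ 0 < deriv F sp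

/-- The ODE (⋆) `u'' + (p/r) u' - (q/r²) u = F(u)` holds at the point `r`. -/
def ODEAt (p q : ℝ) (F : ℝ → ℝ) (u : ℝ → ℝ) (r : ℝ) : Prop :=
  deriv (deriv u) r + (p / r) * deriv u r - (q / r ^ 2) * u r = F (u r)

/-- `ψ` is locally Lipschitz on the set `I`. -/
def LocLipOn (I : Set ℝ) (ψ : ℝ → ℝ) : Prop :=
  ∀ x ∈ I, ∃ K : ℝ≥0, ∃ t ∈ nhdsWithin x I, LipschitzOnWith K ψ t

/-- `ψ` is a locally Lipschitz, piecewise `C²` super-solution of (⋆) on `I`: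
outside a locally finite set `S` of jump points it is `C²` and satisfies
`ψ'' + (p/r)ψ' - (q/r²)ψ ≤ F(ψ)`, and at each jump point the one-sided
derivatives exist with `ψ'(r₀⁻) > ψ'(r₀⁺)`. -/
def IsSuperSolutionOn (p q : ℝ) (F : ℝ → ℝ) (I : Set ℝ) (ψ : ℝ → ℝ) : Prop :=
  LocLipOn I ψ ∧
    ∃ S : Set ℝ,
      (∀ x ∈ I, ∃ ε > 0, (S ∩ Set.Ioo (x - ε) (x + ε)).Finite) ∧
      (∀ x ∈ I \ S, ContDiffAt ℝ 2 ψ x ∧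
        deriv (deriv ψ) x + (p / x) * deriv ψ x - (q / x ^ 2) * ψ x ≤ F (ψ x)) ∧
      (∀ x ∈ I ∩ S, ∃ dl dr : ℝ, HasDerivWithinAt ψ dl (Set.Iio x) x ∧
        HasDerivWithinAt ψ dr (Set.Ioi x) x ∧ dr < dl)

/-- `ψ` is a locally Lipschitz, piecewise `C²` sub-solution of (⋆) on `I`. -/
def IsSubSolutionOn (p q : ℝ) (F : ℝ → ℝ) (I : Set ℝ) (ψ : ℝ → ℝ) : Prop :=
  LocLipOn I ψ ∧
    ∃ S : Set ℝ,
      (∀ x ∈ I, ∃ ε > 0, (S ∩ Set.Ioo (x - ε) (x + ε)).Finite) ∧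
      (∀ x ∈ I \ S, ContDiffAt ℝ 2 ψ x ∧
        F (ψ x) ≤ deriv (deriv ψ) x + (p / x) * deriv ψ x - (q / x ^ 2) * ψ x) ∧
      (∀ x ∈ I ∩ S, ∃ dl dr : ℝ, HasDerivWithinAt ψ dl (Set.Iio x) x ∧
        HasDerivWithinAt ψ dr (Set.Ioi x) x ∧ dl < dr)

/-- `u(r) = α·r^γ + o(r^γ)` as `r → 0⁺`. -/
def AsympZero (u : ℝ → ℝ) (α γ : ℝ) : Prop :=
  Filter.Tendsto (fun r : ℝ => (u r - α * r ^ γ) / r ^ γ) (nhdsWithin 0 (Set.Ioi 0)) (nhds 0)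

/-- `u(r) = sp - β·r⁻² + o(r⁻²)` as `r → ∞`. -/
def AsympInfty (u : ℝ → ℝ) (sp β : ℝ) : Prop :=
  Filter.Tendsto (fun r : ℝ => (u r - (sp - β / r ^ 2)) * r ^ 2) Filter.atTop (nhds 0)

/-- At `x`, either `w` is twice differentiable with `w'' + (p/x) w' ≤ M`, or `w` has a concave
corner. -/
def SuperAt (p : ℝ) (w : ℝ → ℝ) (x M : ℝ) : Prop :=
  (∃ (w1 : ℝ → ℝ) (w2 : ℝ), (∀ᶠ y in 𝓝 x, HasDerivAt w (w1 y) y) ∧ HasDerivAt w1 w2 x ∧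
      w2 + p / x * w1 x ≤ M) ∨
    ∃ dl dr : ℝ, HasDerivWithinAt w dl (Iio x) x ∧ HasDerivWithinAt w dr (Ioi x) x ∧ dr < dl

namespace SuperAt

variable {p x A B l : ℝ} {u v : ℝ → ℝ}

theorem mono (h : SuperAt p u x A) (hAB : A ≤ B) : SuperAt p u x B := by
  rcases h with ⟨w1, w2, h1, h2, h3⟩ | h
  · exact Or.inl ⟨w1, w2, h1, h2, h3.trans hAB⟩
  · exact Or.inr h

theorem add (hu : SuperAt p u x A) (hv : SuperAt p v x B) :
    SuperAt p (fun y => u y + v y) x (A + B) := by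
  rcases hu with ⟨u1, u2, h1, h2, h3⟩ | ⟨dl, dr, hl, hr, hd⟩ <;>
    rcases hv with ⟨v1, v2, k1, k2, k3⟩ | ⟨el, er, kl, kr, kd⟩
  · refine Or.inl ⟨fun y => u1 y + v1 y, u2 + v2, ?_, h2.add k2, by linarith⟩
    filter_upwards [h1, k1] with y hy ky using hy.add ky
  · exact Or.inr ⟨_, _, h1.self_of_nhds.hasDerivWithinAt.add kl,
      h1.self_of_nhds.hasDerivWithinAt.add kr, by linarith⟩
  · exact Or.inr ⟨_, _, hl.add k1.self_of_nhds.hasDerivWithinAt,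
      hr.add k1.self_of_nhds.hasDerivWithinAt, by linarith⟩
  · exact Or.inr ⟨_, _, hl.add kl, hr.add kr, by linarith⟩

theorem comp_mul (hl : 0 < l) (hx : 0 < x) (h : SuperAt p u (l * x) A) :
    SuperAt p (fun y => u (l * y)) x (l ^ 2 * A) := by
  have hlin : ∀ y, HasDerivAt (fun y : ℝ => l * y) l y := fun y => by
    simpa using (hasDerivAt_id y).const_mul l
  rcases h with ⟨u1, u2, h1, h2, h3⟩ | ⟨dl, dr, hdl, hdr, hd⟩
  · refine Or.inl ⟨fun y => u1 (l * y) * l, u2 * l * l, ?_, ?_, ?_⟩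
    · filter_upwards [(hlin x).continuousAt.eventually h1] with y hy
      exact hy.comp y (hlin y)
    · exact (h2.comp x (hlin x)).mul_const l
    · have e : u2 * l * l + p / x * (u1 (l * x) * l)
          = l ^ 2 * (u2 + p / (l * x) * u1 (l * x)) := by
        field_simp
      rw [e]
      exact mul_le_mul_of_nonneg_left h3 (by positivity)
  · refine Or.inr ⟨dl * l, dr * l, ?_, ?_, by nlinarith⟩
    · exact hdl.comp x (hlin x).hasDerivWithinAt fun y hy => mul_lt_mul_of_pos_left hy hl
    · exact hdr.comp x (hlin x).hasDerivWithinAt fun y hy => mul_lt_mul_of_pos_left hy hl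

theorem nonneg_of_isLocalMin (h : SuperAt p u x A) (hmin : IsLocalMin u x) : 0 ≤ A := by
  rcases h with ⟨u1, u2, h1, h2, h3⟩ | ⟨dl, dr, hdl, hdr, hd⟩
  · have h0 : u1 x = 0 := hmin.hasDerivAt_eq_zero h1.self_of_nhds
    suffices 0 ≤ u2 by rw [h0] at h3; linarith
    by_contra! hneg
    have hderiv : deriv u =ᶠ[𝓝 x] u1 := h1.mono fun y hy => hy.deriv
    have hdd : deriv (deriv u) x = u2 := by rw [hderiv.deriv_eq, h2.deriv]
    have hmax : IsLocalMax u x := isLocalMax_of_deriv_deriv_neg (by rw [hdd]; exact hneg)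
      (by rw [hderiv.self_of_nhds, h0]) h1.self_of_nhds.continuousAt
    have hconst : u =ᶠ[𝓝 x] fun _ => u x := by
      filter_upwards [hmin, hmax] with y a b using le_antisymm b a
    have : deriv (deriv u) x = 0 := by
      rw [hconst.deriv.deriv_eq]; simp
    linarith
  · exfalso
    have hl : dl ≤ 0 := by
      have ht := (hasDerivWithinAt_iff_tendsto_slope' (by simp)).1 hdl
      refine le_of_tendsto ht ?_
      filter_upwards [self_mem_nhdsWithin, nhdsWithin_le_nhds hmin] with y hy hm
      rw [slope_def_field]
      exact div_nonpos_of_nonneg_of_nonpos (sub_nonneg.2 hm) (sub_nonpos.2 (le_of_lt hy))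
    have hr : 0 ≤ dr := by
      have ht := (hasDerivWithinAt_iff_tendsto_slope' (by simp)).1 hdr
      refine ge_of_tendsto ht ?_
      filter_upwards [self_mem_nhdsWithin, nhdsWithin_le_nhds hmin] with y hy hm
      rw [slope_def_field]
      exact div_nonneg (sub_nonneg.2 hm) (sub_nonneg.2 (le_of_lt hy))
    linarith

end SuperAt

theorem ContDiffAt.eventually_hasDerivAt_deriv {ψ : ℝ → ℝ} {x : ℝ} (h : ContDiffAt ℝ 2 ψ x) :
    (∀ᶠ y in 𝓝 x, HasDerivAt ψ (deriv ψ y) y) ∧ HasDerivAt (deriv ψ) (deriv (deriv ψ) x) x := by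
  constructor
  · filter_upwards [h.eventually (by simp)] with y hy
    exact (hy.differentiableAt (by norm_num)).hasDerivAt
  · have h1 : ContDiffAt ℝ 1 (deriv ψ) x := by
      simpa using h.derivWithin (m := 1) (by norm_num)
    exact (h1.differentiableAt (by norm_num)).hasDerivAt

theorem IsSuperSolutionOn.superAt {p q : ℝ} {F ψ : ℝ → ℝ} {I : Set ℝ}
    (h : IsSuperSolutionOn p q F I ψ) {x : ℝ} (hx : x ∈ I) :
    SuperAt p ψ x (q / x ^ 2 * ψ x + F (ψ x)) := by
  obtain ⟨-, S, -, hsm, hj⟩ := h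
  by_cases hS : x ∈ S
  · exact Or.inr (hj x ⟨hx, hS⟩)
  · obtain ⟨hc, hle⟩ := hsm x ⟨hx, hS⟩
    obtain ⟨h1, h2⟩ := hc.eventually_hasDerivAt_deriv
    exact Or.inl ⟨_, _, h1, h2, by linarith⟩

theorem IsSubSolutionOn.superAt_neg {p q : ℝ} {F ψ : ℝ → ℝ} {I : Set ℝ}
    (h : IsSubSolutionOn p q F I ψ) {x : ℝ} (hx : x ∈ I) :
    SuperAt p (fun y => -ψ y) x (-(q / x ^ 2 * ψ x + F (ψ x))) := by
  obtain ⟨-, S, -, hsm, hj⟩ := h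
  by_cases hS : x ∈ S
  · obtain ⟨dl, dr, hl, hr, hd⟩ := hj x ⟨hx, hS⟩
    exact Or.inr ⟨-dl, -dr, hl.neg, hr.neg, by linarith⟩
  · obtain ⟨hc, hle⟩ := hsm x ⟨hx, hS⟩
    obtain ⟨h1, h2⟩ := hc.eventually_hasDerivAt_deriv
    exact Or.inl ⟨fun y => -deriv ψ y, _, h1.mono fun y hy => hy.neg, h2.neg, by
      simp only [mul_neg]; linarith⟩

theorem LocLipOn.continuousOn {I : Set ℝ} {ψ : ℝ → ℝ} (h : LocLipOn I ψ) :
    ContinuousOn ψ I := by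
  intro x hx
  obtain ⟨K, t, ht, hK⟩ := h x hx
  exact (hK.continuousOn x (mem_of_mem_nhdsWithin hx ht)).mono_of_mem_nhdsWithin ht

/-- Minimum principle: a function that cannot have a negative interior local minimum, and whose
negative part vanishes at both endpoints, is nonnegative. -/
theorem nonneg_of_no_neg_isLocalMin {z : ℝ → ℝ} {a b : ℝ} (hz : ContinuousOn z (Ioo a b))
    (ha : ∀ ε > 0, ∀ᶠ x in 𝓝[>] a, -ε < z x) (hb : ∀ ε > 0, ∀ᶠ x in 𝓝[<] b, -ε < z x)
    (hmin : ∀ x ∈ Ioo a b, IsLocalMin z x → 0 ≤ z x) : ∀ x ∈ Ioo a b, 0 ≤ z x := by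
  intro x hx
  by_contra! hneg
  obtain ⟨a', ha', haz⟩ := ((ha (-z x) (by linarith)).and (Ioo_mem_nhdsGT hx.1)).exists.imp
    fun y hy => And.symm hy
  obtain ⟨b', hb', hbz⟩ := ((hb (-z x) (by linarith)).and (Ioo_mem_nhdsLT hx.2)).exists.imp
    fun y hy => And.symm hy
  have hsub : Icc a' b' ⊆ Ioo a b := fun y hy => ⟨ha'.1.trans_le hy.1, hy.2.trans_lt hb'.2⟩
  have hxm : x ∈ Icc a' b' := ⟨ha'.2.le, hb'.1.le⟩
  obtain ⟨y, hy, hymin⟩ := isCompact_Icc.exists_isMinOn ⟨x, hxm⟩ (hz.mono hsub)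
  have hyx : z y ≤ z x := hymin hxm
  have h1 : a' < y := lt_of_le_of_ne hy.1 fun h => by rw [← h] at hyx; linarith
  have h2 : y < b' := lt_of_le_of_ne hy.2 fun h => by rw [h] at hyx; linarith
  have := hmin y (hsub hy) (hymin.isLocalMin (Icc_mem_nhds h1 h2))
  linarith

/-- Comparison of a supersolution `w` of the linear equation `w'' + (p/r) w' = V(r) w`, `V > 0`,
with a multiple of a smooth subsolution `φ`. -/
theorem mul_le_of_barrier {p a b c : ℝ} {V w φ φ1 φ2 : ℝ → ℝ} (hc : 0 ≤ c)
    (hw : ContinuousOn w (Ioo a b)) (hsuper : ∀ x ∈ Ioo a b, SuperAt p w x (V x * w x))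
    (hV : ∀ x ∈ Ioo a b, 0 < V x) (hφ : ∀ x ∈ Ioo a b, HasDerivAt φ (φ1 x) x)
    (hφ1 : ∀ x ∈ Ioo a b, HasDerivAt φ1 (φ2 x) x)
    (hsub : ∀ x ∈ Ioo a b, V x * φ x ≤ φ2 x + p / x * φ1 x)
    (ha : ∀ ε > 0, ∀ᶠ x in 𝓝[>] a, -ε < w x - c * φ x)
    (hb : ∀ ε > 0, ∀ᶠ x in 𝓝[<] b, -ε < w x - c * φ x) :
    ∀ x ∈ Ioo a b, c * φ x ≤ w x := by
  intro x hx
  refine sub_nonneg.1 (nonneg_of_no_neg_isLocalMin (z := fun x => w x - c * φ x) ?_ ha hb ?_ x hx)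
  · exact hw.sub (continuousOn_const.mul fun y hy => (hφ y hy).continuousAt.continuousWithinAt)
  · intro y hy hmin
    have hs : SuperAt p (fun y => -(c * φ y)) y (-(c * (φ2 y + p / y * φ1 y))) := by
      refine Or.inl ⟨fun y => -(c * φ1 y), _, ?_, ((hφ1 y hy).const_mul c).neg, by
        apply le_of_eq; ring⟩
      filter_upwards [isOpen_Ioo.mem_nhds hy] with t ht using ((hφ t ht).const_mul c).neg
    have h := ((hsuper y hy).add hs).nonneg_of_isLocalMin (by simpa only [sub_eq_add_neg] using hmin)
    have h2 := mul_le_mul_of_nonneg_left (hsub y hy) hc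
    have h3 : 0 ≤ V y * (w y - c * φ y) := by linarith
    exact nonneg_of_mul_nonneg_right h3 (hV y hy)

/-- Positivity at `r₁` of a nonnegative supersolution propagates to every point `r₀`; `k` is the
rate of the exponential barrier and `r₂` its far endpoint. -/
theorem pos_of_exp_barrier {p a b r₁ r₂ k r₀ : ℝ} {V w : ℝ → ℝ}
    (hw : ContinuousOn w (Icc a b)) (hnn : ∀ x ∈ Icc a b, 0 ≤ w x)
    (hsuper : ∀ x ∈ Ioo a b, SuperAt p w x (V x * w x))
    (hV : ∀ x ∈ Ioo a b, 0 < V x) (hk : ∀ x ∈ Ioo a b, V x + p / x * k ≤ k ^ 2)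
    (hr₁ : 0 < w r₁) (hends : r₁ = a ∧ r₂ = b ∨ r₁ = b ∧ r₂ = a)
    (hdec : Real.exp (-k * r₂) < Real.exp (-k * r₀)) (hr₀ : r₀ ∈ Ioo a b) : 0 < w r₀ := by
  have hab : a < b := hr₀.1.trans hr₀.2
  set φ : ℝ → ℝ := fun x => Real.exp (-k * x) - Real.exp (-k * r₂) with hφdef
  have hexp : ∀ x, HasDerivAt (fun x => Real.exp (-k * x)) (-k * Real.exp (-k * x)) x := fun x => by
    have := ((hasDerivAt_id x).const_mul (-k)).exp
    simpa [mul_comm] using this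
  have hφ2 : φ r₂ = 0 := by simp [hφdef]
  set c := w r₁ / (|φ r₁| + 1) with hcdef
  have hcpos : 0 < c := by positivity
  have hcφ : c * φ r₁ ≤ w r₁ := by
    rw [hcdef, div_mul_eq_mul_div, div_le_iff₀ (by positivity)]
    exact mul_le_mul_of_nonneg_left ((le_abs_self _).trans (by linarith)) hr₁.le
  have hr₂ : c * φ r₂ ≤ w r₂ := by
    rw [hφ2, mul_zero]
    rcases hends with ⟨-, rfl⟩ | ⟨-, rfl⟩
    · exact hnn _ ⟨hab.le, le_rfl⟩
    · exact hnn _ ⟨le_rfl, hab.le⟩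
  have hφc : Continuous φ := by fun_prop
  have hcont : ContinuousOn (fun x => w x - c * φ x) (Icc a b) :=
    hw.sub (by fun_prop)
  have hA : c * φ a ≤ w a := by
    rcases hends with ⟨rfl, rfl⟩ | ⟨rfl, rfl⟩ <;> assumption
  have hB : c * φ b ≤ w b := by
    rcases hends with ⟨rfl, rfl⟩ | ⟨rfl, rfl⟩ <;> assumption
  refine lt_of_lt_of_le (mul_pos hcpos (sub_pos.2 hdec))
    (mul_le_of_barrier (φ := φ) (φ1 := fun x => -k * Real.exp (-k * x))
      (φ2 := fun x => -k * (-k * Real.exp (-k * x))) hcpos.le (hw.mono Ioo_subset_Icc_self) hsuper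
      hV (fun x _ => (hexp x).sub_const _) (fun x _ => (hexp x).const_mul _) ?_ ?_ ?_ r₀ hr₀)
  · intro x hx
    have h1 : V x * φ x ≤ V x * Real.exp (-k * x) :=
      mul_le_mul_of_nonneg_left (sub_le_self _ (Real.exp_pos _).le) (hV x hx).le
    have h2 := mul_le_mul_of_nonneg_right (hk x hx) (Real.exp_pos (-k * x)).le
    linarith
  · intro ε hε
    have h1 : Tendsto (fun x => w x - c * φ x) (𝓝[>] a) (𝓝 (w a - c * φ a)) :=
      (hcont a ⟨le_rfl, hab.le⟩).mono_left (nhdsWithin_Ioo_eq_nhdsGT hab ▸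
        nhdsWithin_mono _ Ioo_subset_Icc_self)
    exact h1.eventually (lt_mem_nhds (by linarith))
  · intro ε hε
    have h1 : Tendsto (fun x => w x - c * φ x) (𝓝[<] b) (𝓝 (w b - c * φ b)) :=
      (hcont b ⟨hab.le, le_rfl⟩).mono_left (nhdsWithin_Ioo_eq_nhdsLT hab ▸
        nhdsWithin_mono _ Ioo_subset_Icc_self)
    exact h1.eventually (lt_mem_nhds (by linarith))

/-- Strong maximum principle on `(0, ∞)`. -/
theorem eq_zero_of_superAt {p q K r₀ : ℝ} {w : ℝ → ℝ} (hp : 0 ≤ p) (hq : 0 < q) (hK : 0 ≤ K)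
    (hw : ContinuousOn w (Ioi 0)) (hnn : ∀ x, 0 < x → 0 ≤ w x)
    (hsuper : ∀ x, 0 < x → SuperAt p w x ((q / x ^ 2 + K) * w x))
    (hr₀ : 0 < r₀) (h0 : w r₀ = 0) : ∀ r, 0 < r → w r = 0 := by
  intro r hr
  by_contra hne
  have hpos : 0 < w r := lt_of_le_of_ne (hnn r hr) (Ne.symm hne)
  have hrr : r ≠ r₀ := fun h => hne (h ▸ h0)
  have key : ∀ m, 0 < m → ∃ k > 0, ∀ x, m < x →
      q / x ^ 2 + K + p / x * k ≤ k ^ 2 ∧ q / x ^ 2 + K + p / x * -k ≤ (-k) ^ 2 := by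
    intro m hm
    refine ⟨q / m ^ 2 + K + p / m + 1, by positivity, fun x hx => ?_⟩
    have hx0 : 0 < x := hm.trans hx
    have e1 : q / x ^ 2 ≤ q / m ^ 2 := by gcongr
    have e2 : p / x ≤ p / m := by gcongr
    have e3 : 0 ≤ p / x := by positivity
    have e4 : 0 < q / m ^ 2 := by positivity
    generalize q / m ^ 2 = Q at *
    generalize q / x ^ 2 = Q' at *
    generalize p / m = P at *
    generalize p / x = P' at *
    constructor <;> nlinarith [mul_nonneg e3 (by linarith : 0 ≤ Q + K + P + 1),
      mul_le_mul_of_nonneg_right e2 (by linarith : 0 ≤ Q + K + P + 1)]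
  suffices 0 < w r₀ by linarith
  rcases lt_or_gt_of_ne hrr with hlt | hlt
  · obtain ⟨k, hk, hkx⟩ := key r hr
    refine pos_of_exp_barrier (p := p) (a := r) (b := r₀ + 1) (r₁ := r) (r₂ := r₀ + 1) (k := k)
      (V := fun x => q / x ^ 2 + K)
      (hw.mono fun x hx => hr.trans_le hx.1) (fun x hx => hnn x (hr.trans_le hx.1))
      (fun x hx => hsuper x (hr.trans hx.1)) (fun x hx => ?_) (fun x hx => (hkx x hx.1).1)
      hpos (Or.inl ⟨rfl, rfl⟩) (Real.exp_lt_exp.2 (by nlinarith)) ⟨hlt, by linarith⟩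
    have := hr.trans hx.1
    positivity
  · have hm : 0 < r₀ / 2 := by positivity
    obtain ⟨k, hk, hkx⟩ := key (r₀ / 2) hm
    refine pos_of_exp_barrier (p := p) (a := r₀ / 2) (b := r) (r₁ := r) (r₂ := r₀ / 2) (k := -k)
      (V := fun x => q / x ^ 2 + K)
      (hw.mono fun x hx => hm.trans_le hx.1) (fun x hx => hnn x (hm.trans_le hx.1))
      (fun x hx => hsuper x (hm.trans hx.1)) (fun x hx => ?_) (fun x hx => (hkx x hx.1).2)
      hpos (Or.inr ⟨rfl, rfl⟩) (Real.exp_lt_exp.2 (by nlinarith)) ⟨by linarith, hlt⟩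
    have := hm.trans hx.1
    positivity

theorem gammaPlus_pos {p q : ℝ} (hq : 0 < q) : 0 < gammaPlus p q := by
  have h : |p - 1| < Real.sqrt ((p - 1) ^ 2 + 4 * q) := by
    rw [← Real.sqrt_sq_eq_abs]
    exact Real.sqrt_lt_sqrt (sq_nonneg _) (by linarith)
  unfold gammaPlus
  linarith [le_abs_self (p - 1)]

theorem gammaPlus_root {p q : ℝ} (hq : 0 < q) :
    gammaPlus p q ^ 2 + (p - 1) * gammaPlus p q = q := by
  have h := Real.sq_sqrt (by positivity : 0 ≤ (p - 1) ^ 2 + 4 * q)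
  unfold gammaPlus
  linarith

/-- Hopf-type lemma at the origin: a positive supersolution is bounded below by a multiple of
`r ^ γ₊`. -/
theorem exists_mul_rpow_le {p q K : ℝ} {w : ℝ → ℝ} (hp : 0 ≤ p) (hq : 0 < q) (hK : 0 ≤ K)
    (hw : ContinuousOn w (Ioi 0)) (hpos : ∀ x, 0 < x → 0 < w x)
    (hsuper : ∀ x, 0 < x → SuperAt p w x ((q / x ^ 2 + K) * w x)) :
    ∃ c > 0, ∃ δ > 0, ∀ x ∈ Ioo 0 δ, c * x ^ gammaPlus p q ≤ w x := by
  set γ := gammaPlus p q with hγdef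
  have hγ : 0 < γ := gammaPlus_pos hq
  have hroot : γ ^ 2 + (p - 1) * γ = q := gammaPlus_root hq
  set κ := 2 * γ + p with hκ
  have hκ0 : 0 < κ := by positivity
  set δ := min 1 (κ / (2 * K + 1)) with hδdef
  have hδ : 0 < δ := by positivity
  set φ : ℝ → ℝ := fun x => x ^ γ + x ^ (γ + 1) with hφdef
  have hφpos : ∀ x, 0 < x → 0 < φ x := fun x hx => by positivity
  set c := w δ / φ δ with hc
  have hcpos : 0 < c := div_pos (hpos δ hδ) (hφpos δ hδ)
  have hφc : Continuous φ :=
    (Real.continuous_rpow_const hγ.le).add (Real.continuous_rpow_const (by linarith))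
  have hmain : ∀ x ∈ Ioo 0 δ, c * φ x ≤ w x := by
    refine mul_le_of_barrier (p := p) (V := fun x => q / x ^ 2 + K)
      (φ1 := fun x => γ * x ^ (γ - 1) + (γ + 1) * x ^ (γ + 1 - 1))
      (φ2 := fun x => γ * ((γ - 1) * x ^ (γ - 1 - 1)) +
        (γ + 1) * ((γ + 1 - 1) * x ^ (γ + 1 - 1 - 1))) hcpos.le
      (hw.mono fun x hx => hx.1) (fun x hx => hsuper x hx.1) ?_ ?_ ?_ ?_ ?_ ?_
    · intro x hx
      have := hx.1
      positivity
    · intro x hx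
      exact (Real.hasDerivAt_rpow_const (Or.inl hx.1.ne')).add
        (Real.hasDerivAt_rpow_const (Or.inl hx.1.ne'))
    · intro x hx
      exact ((Real.hasDerivAt_rpow_const (Or.inl hx.1.ne')).const_mul _).add
        ((Real.hasDerivAt_rpow_const (Or.inl hx.1.ne')).const_mul _)
    · intro x hx
      have hx0 : 0 < x := hx.1
      have hx1 : x ≤ 1 := hx.2.le.trans (min_le_left _ _)
      have hx2 : x * (2 * K + 1) ≤ κ := by
        rw [← le_div_iff₀ (by positivity)]
        exact hx.2.le.trans (min_le_right _ _)
      set y := x ^ (γ - 1 - 1) with hy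
      have hy0 : 0 < y := by positivity
      have e1 : x ^ (γ - 1) = y * x := by
        rw [hy, ← Real.rpow_add_one hx0.ne']; congr 1; ring
      have e2 : x ^ γ = y * x ^ 2 := by
        rw [pow_two, ← mul_assoc, ← e1, ← Real.rpow_add_one hx0.ne']; congr 1; ring
      have e3 : x ^ (γ + 1) = y * x ^ 3 := by
        rw [Real.rpow_add_one hx0.ne', e2]; ring
      simp only [hφdef, add_sub_cancel_right]
      rw [e3, e2, e1, ← sub_nonneg]
      have e4 : γ * ((γ - 1) * y) + (γ + 1) * (γ * (y * x)) +
          p / x * (γ * (y * x) + (γ + 1) * (y * x ^ 2)) -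
          (q / x ^ 2 + K) * (y * x ^ 2 + y * x ^ 3)
          = y * x * (κ - K * x - K * x ^ 2) := by
        rw [← hroot, hκ]; field_simp; ring
      rw [e4]
      have : K * x ^ 2 ≤ K * x := mul_le_mul_of_nonneg_left (by nlinarith) hK
      have : 0 ≤ κ - K * x - K * x ^ 2 := by linarith
      positivity
    · intro ε hε
      have hφ0 : Tendsto (fun x => c * φ x) (𝓝[>] 0) (𝓝 0) := by
        have : Tendsto (fun x => c * φ x) (𝓝 0) (𝓝 (c * φ 0)) := (hφc.const_mul c).tendsto 0
        have h0 : φ 0 = 0 := by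
          simp [hφdef, Real.zero_rpow hγ.ne', Real.zero_rpow (by linarith : γ + 1 ≠ 0)]
        rw [h0, mul_zero] at this
        exact this.mono_left nhdsWithin_le_nhds
      filter_upwards [hφ0.eventually (gt_mem_nhds hε), self_mem_nhdsWithin] with x h1 h2
      linarith [hpos x h2]
    · intro ε hε
      have hcont : ContinuousAt (fun x => w x - c * φ x) δ :=
        (hw.continuousAt (Ioi_mem_nhds hδ)).sub (hφc.const_mul c).continuousAt
      have h0 : w δ - c * φ δ = 0 := by
        rw [hc, div_mul_cancel₀ _ (hφpos δ hδ).ne', sub_self]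
      have := hcont.tendsto.mono_left (nhdsWithin_le_nhds (s := Iio δ))
      rw [h0] at this
      exact this.eventually (lt_mem_nhds (by linarith))
  refine ⟨c, hcpos, δ, hδ, fun x hx => le_trans ?_ (hmain x hx)⟩
  have := Real.rpow_pos_of_pos hx.1 (γ + 1)
  exact mul_le_mul_of_nonneg_left (by simp only [hφdef]; linarith) hcpos.le

theorem IsSuperSolutionOn.superAt_comp_mul_sub {p q l x : ℝ} {F u v : ℝ → ℝ}
    (hu : IsSuperSolutionOn p q F (Ioi 0) u) (hv : IsSubSolutionOn p q F (Ioi 0) v)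
    (hl : 0 < l) (hx : 0 < x) :
    SuperAt p (fun y => u (l * y) - v y) x
      (q / x ^ 2 * (u (l * x) - v x) + (l ^ 2 * F (u (l * x)) - F (v x))) := by
  have h := ((hu.superAt (mem_Ioi.2 (mul_pos hl hx))).comp_mul hl hx).add
    (hv.superAt_neg (mem_Ioi.2 hx))
  simp only [← sub_eq_add_neg] at h
  refine h.mono (le_of_eq ?_)
  field_simp
  ring

namespace CondF

variable {F : ℝ → ℝ} {sp : ℝ}

theorem nonpos (hF : CondF F sp) {t : ℝ} (h0 : 0 ≤ t) (h1 : t ≤ sp) : F t ≤ 0 := by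
  obtain ⟨-, hF0, hFs, hneg, -⟩ := hF
  rcases h0.eq_or_lt with rfl | h0
  · exact hF0.le
  rcases h1.eq_or_lt with rfl | h1
  · exact hFs.le
  exact (hneg t ⟨h0, h1⟩).le

theorem exists_lipschitz (hF : CondF F sp) :
    ∃ K, 0 ≤ K ∧ ∀ a b, 0 ≤ a → a ≤ b → b ≤ sp → F b - F a ≤ K * (b - a) := by
  obtain ⟨K, hK⟩ := LocallyLipschitzOn.exists_lipschitzOnWith_of_compact
    (isCompact_Icc (a := (0 : ℝ)) (b := sp)) (hF.1.locallyLipschitz.locallyLipschitzOn)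
  refine ⟨K, K.2, fun a b ha hab hb => ?_⟩
  have h := hK.dist_le_mul b ⟨ha.trans hab, hb⟩ a ⟨ha, hab.trans hb⟩
  rw [Real.dist_eq, Real.dist_eq, abs_of_nonneg (sub_nonneg.2 hab)] at h
  exact (le_abs_self _).trans h

end CondF

theorem AsympZero.tendsto_div {u : ℝ → ℝ} {α γ : ℝ} (h : AsympZero u α γ) :
    Tendsto (fun r => u r / r ^ γ) (𝓝[>] 0) (𝓝 α) := by
  have h' := h.add_const α
  rw [zero_add] at h'
  refine h'.congr' ?_
  filter_upwards [self_mem_nhdsWithin] with r hr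
  have : r ^ γ ≠ 0 := (Real.rpow_pos_of_pos hr γ).ne'
  field_simp
  ring

theorem AsympInfty.tendsto {u : ℝ → ℝ} {sp β : ℝ} (h : AsympInfty u sp β) :
    Tendsto u atTop (𝓝 sp) := by
  have hinv : Tendsto (fun r : ℝ => (r ^ 2)⁻¹) atTop (𝓝 0) :=
    tendsto_inv_atTop_zero.comp (tendsto_pow_atTop two_ne_zero)
  have h' := ((h.mul hinv).sub (hinv.const_mul β)).const_add sp
  simp only [mul_zero, sub_zero, add_zero] at h'
  refine h'.congr' ?_
  filter_upwards [eventually_gt_atTop 0] with r hr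
  field_simp
  ring

/-- A bounded function of order `r ^ γ` at the origin lies below a multiple of `r ^ γ`. -/
theorem AsympZero.exists_le_mul_rpow {u : ℝ → ℝ} {α γ s : ℝ} (hγ : 0 < γ) (hs : 0 ≤ s)
    (h : AsympZero u α γ) (hu : ∀ r, 0 < r → u r ≤ s) :
    ∃ C > 0, ∀ r, 0 < r → u r ≤ C * r ^ γ := by
  obtain ⟨δ, hδ, hδu⟩ := (mem_nhdsGT_iff_exists_Ioo_subset.1
    (h.tendsto_div.eventually (gt_mem_nhds (lt_add_one α))))
  have hδ : 0 < δ := hδ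
  refine ⟨|α| + 1 + s / δ ^ γ, by positivity, fun r hr => ?_⟩
  have hrγ : 0 < r ^ γ := Real.rpow_pos_of_pos hr γ
  have hδγ : 0 < δ ^ γ := Real.rpow_pos_of_pos hδ γ
  rw [← div_le_iff₀ hrγ]
  rcases lt_or_ge r δ with hlt | hge
  · have h1 : u r / r ^ γ < α + 1 := hδu ⟨hr, hlt⟩
    have : 0 ≤ s / δ ^ γ := by positivity
    linarith [le_abs_self α]
  · have h1 : u r / r ^ γ ≤ s / δ ^ γ := by
      have := Real.rpow_le_rpow hδ.le hge hγ.le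
      gcongr
      exact hu r hr
    linarith [abs_nonneg α]

/-- A positive function with positive leading coefficient at the origin lies above a multiple of
`r ^ γ` on bounded intervals. -/
theorem AsympZero.exists_mul_rpow_le {u : ℝ → ℝ} {α γ : ℝ} (R : ℝ) (hα : 0 < α)
    (h : AsympZero u α γ) (hc : ContinuousOn u (Ioi 0)) (hpos : ∀ r, 0 < r → 0 < u r) :
    ∃ c > 0, ∀ r ∈ Ioc 0 R, c * r ^ γ ≤ u r := by
  obtain ⟨δ, hδ, hδu⟩ := (mem_nhdsGT_iff_exists_Ioo_subset.1
    (h.tendsto_div.eventually (lt_mem_nhds (half_lt_self hα))))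
  have hδ : 0 < δ := hδ
  have hcont : ContinuousOn (fun r => u r / r ^ γ) (Icc δ R) := by
    refine (hc.mono fun r hr => hδ.trans_le hr.1).div ?_ fun r hr =>
      (Real.rpow_pos_of_pos (hδ.trans_le hr.1) γ).ne'
    exact fun r hr => (Real.continuousAt_rpow_const r γ
      (Or.inl (hδ.trans_le hr.1).ne')).continuousWithinAt
  obtain ⟨c', hc', hcu⟩ : ∃ c > 0, ∀ r ∈ Icc δ R, c ≤ u r / r ^ γ := by
    rcases (Icc δ R).eq_empty_or_nonempty with he | hne
    · exact ⟨1, one_pos, by simp [he]⟩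
    · obtain ⟨y, hy, hmin⟩ := isCompact_Icc.exists_isMinOn hne hcont
      have hy0 : 0 < y := hδ.trans_le hy.1
      exact ⟨u y / y ^ γ, div_pos (hpos y hy0) (Real.rpow_pos_of_pos hy0 γ),
        fun r hr => hmin hr⟩
  refine ⟨min (α / 2) c', by positivity, fun r hr => ?_⟩
  rw [← le_div_iff₀ (Real.rpow_pos_of_pos hr.1 γ)]
  rcases lt_or_ge r δ with hlt | hge
  · exact (min_le_left _ _).trans (le_of_lt (hδu ⟨hr.1, hlt⟩))
  · exact (min_le_right _ _).trans (hcu r ⟨hge, hr.2⟩)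

/-- A supersolution with positive leading coefficient at the origin is positive. -/
theorem IsSuperSolutionOn.pos {p q sp α : ℝ} {F u : ℝ → ℝ} (hp : 0 ≤ p) (hq : 0 < q)
    (hF : CondF F sp) (hu : IsSuperSolutionOn p q F (Ioi 0) u)
    (hbd : ∀ r ∈ Ioi (0 : ℝ), 0 ≤ u r ∧ u r ≤ sp) (hα : 0 < α)
    (h0 : AsympZero u α (gammaPlus p q)) {r : ℝ} (hr : 0 < r) : 0 < u r := by
  refine lt_of_le_of_ne (hbd r hr).1 fun hne => ?_
  obtain ⟨K, hK, hFK⟩ := hF.exists_lipschitz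
  have hz := eq_zero_of_superAt hp hq hK hu.1.continuousOn (fun x hx => (hbd x hx).1)
    (fun x hx => (hu.superAt hx).mono (by
      have := hFK 0 (u x) le_rfl (hbd x hx).1 (hbd x hx).2
      rw [hF.2.1] at this
      linarith)) hr hne.symm
  have : Tendsto (fun r => u r / r ^ gammaPlus p q) (𝓝[>] 0) (𝓝 0) := by
    refine tendsto_const_nhds.congr' ?_
    filter_upwards [self_mem_nhdsWithin] with x hx
    rw [hz x hx, zero_div]
  exact hα.ne (tendsto_nhds_unique this h0.tendsto_div)

theorem IsSubSolutionOn.lt {p q sp : ℝ} {F u : ℝ → ℝ} (hq : 0 < q) (hsp : 0 < sp)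
    (hF : CondF F sp) (hu : IsSubSolutionOn p q F (Ioi 0) u)
    (hbd : ∀ r ∈ Ioi (0 : ℝ), 0 ≤ u r ∧ u r ≤ sp) {r : ℝ} (hr : 0 < r) : u r < sp := by
  refine lt_of_le_of_ne (hbd r hr).2 fun he => ?_
  have h := (hu.superAt_neg (mem_Ioi.2 hr)).nonneg_of_isLocalMin (by
    filter_upwards [Ioi_mem_nhds hr] with y hy
    rw [he]
    exact neg_le_neg (hbd y hy).2)
  rw [he, hF.2.2.1] at h
  have : 0 < q / r ^ 2 * sp := by positivity
  linarith

/-- A subsolution staying below `sp` at infinity is bounded away from `sp`. -/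
theorem IsSubSolutionOn.exists_le_lt {p q sp α : ℝ} {F u : ℝ → ℝ} (hq : 0 < q) (hsp : 0 < sp)
    (hF : CondF F sp) (hu : IsSubSolutionOn p q F (Ioi 0) u)
    (hbd : ∀ r ∈ Ioi (0 : ℝ), 0 ≤ u r ∧ u r ≤ sp) (h0 : AsympZero u α (gammaPlus p q))
    (hlimsup : limsup u atTop < sp) : ∃ m < sp, ∀ r, 0 < r → u r ≤ m := by
  have hγ : 0 < gammaPlus p q := gammaPlus_pos hq
  obtain ⟨m₁, hm₁, hm₁s⟩ := exists_between hlimsup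
  have hbdd : IsBoundedUnder (· ≤ ·) atTop u :=
    isBoundedUnder_of_eventually_le (a := sp) (by
      filter_upwards [eventually_gt_atTop 0] with r hr using (hbd r hr).2)
  obtain ⟨R, hR⟩ := eventually_atTop.1 (eventually_lt_of_limsup_lt hm₁ hbdd)
  obtain ⟨C, hC, hCu⟩ := h0.exists_le_mul_rpow hγ hsp.le fun r hr => (hbd r hr).2
  have hlim : Tendsto (fun r : ℝ => C * r ^ gammaPlus p q) (𝓝[>] 0) (𝓝 0) := by
    have := ((Real.continuous_rpow_const hγ.le).const_mul C).tendsto 0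
    rw [Real.zero_rpow hγ.ne', mul_zero] at this
    exact this.mono_left nhdsWithin_le_nhds
  obtain ⟨δ, hδ, hδu⟩ := (mem_nhdsGT_iff_exists_Ioo_subset.1
    (hlim.eventually (gt_mem_nhds (half_pos hsp))))
  have hδ : 0 < δ := hδ
  obtain ⟨m₂, hm₂, hm₂u⟩ : ∃ m < sp, ∀ r ∈ Icc δ R, u r ≤ m := by
    rcases (Icc δ R).eq_empty_or_nonempty with he | hne
    · exact ⟨0, hsp, by simp [he]⟩
    · obtain ⟨y, hy, hmax⟩ := isCompact_Icc.exists_isMaxOn hne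
        (hu.1.continuousOn.mono fun r hr => hδ.trans_le hr.1)
      exact ⟨u y, hu.lt hq hsp hF hbd (hδ.trans_le hy.1), fun r hr => hmax hr⟩
  refine ⟨max (sp / 2) (max m₁ m₂), by simp [hsp, hm₁s, hm₂], fun r hr => ?_⟩
  rcases lt_or_ge r δ with h1 | h1
  · exact (hCu r hr).trans ((le_of_lt (hδu ⟨hr, h1⟩)).trans (le_max_left _ _))
  rcases le_or_gt r R with h2 | h2
  · exact (hm₂u r ⟨h1, h2⟩).trans ((le_max_right _ _).trans (le_max_right _ _))
  · exact (hR r h2.le).le.trans ((le_max_left _ _).trans (le_max_right _ _))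

/-- A large dilation of the supersolution lies above the subsolution. -/
theorem exists_dilation_le {γ sp αb αl m : ℝ} {u v : ℝ → ℝ} (hγ : 0 < γ) (hm : m < sp)
    (hsp : 0 ≤ sp) (hα : 0 < αb) (hu0 : AsympZero u αb γ) (hv0 : AsympZero v αl γ)
    (huc : ContinuousOn u (Ioi 0)) (hupos : ∀ r, 0 < r → 0 < u r)
    (hvm : ∀ r, 0 < r → v r ≤ m) (huinf : Tendsto u atTop (𝓝 sp)) :
    ∃ l, 1 ≤ l ∧ ∀ r, 0 < r → v r ≤ u (l * r) := by
  obtain ⟨R, hR⟩ := eventually_atTop.1 (huinf.eventually (lt_mem_nhds hm))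
  obtain ⟨C, hC, hCv⟩ := hv0.exists_le_mul_rpow hγ hsp fun r hr => (hvm r hr).trans hm.le
  obtain ⟨c, hc, hcu⟩ := hu0.exists_mul_rpow_le R hα huc hupos
  obtain ⟨l, hl1, hl⟩ := ((eventually_ge_atTop 1).and
    ((tendsto_rpow_atTop hγ).eventually (eventually_ge_atTop (C / c)))).exists
  refine ⟨l, hl1, fun r hr => ?_⟩
  have hl0 : 0 < l := by linarith
  rcases le_or_gt (l * r) R with h | h
  · refine (hCv r hr).trans (le_trans ?_ (hcu _ ⟨mul_pos hl0 hr, h⟩))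
    rw [Real.mul_rpow hl0.le hr.le, ← mul_assoc]
    rw [div_le_iff₀ hc] at hl
    exact mul_le_mul_of_nonneg_right (by linarith) (Real.rpow_pos_of_pos hr γ).le
  · exact (hvm r hr).trans (hR _ h.le).le

/-- If a dilation of `u` lies strictly above `v`, with strict inequality of the leading coefficients
at the origin and at infinity, then so does every slightly smaller dilation. -/
theorem eventually_dilation_le {γ sp αb αl m l₀ : ℝ} {u v : ℝ → ℝ} (hm : m < sp)
    (hα : 0 < αb) (hu0 : AsympZero u αb γ) (hv0 : AsympZero v αl γ)
    (huc : ContinuousOn u (Ioi 0)) (hvc : ContinuousOn v (Ioi 0))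
    (hvm : ∀ r, 0 < r → v r ≤ m) (huinf : Tendsto u atTop (𝓝 sp)) (hl₀ : 1 < l₀)
    (hlt : ∀ r, 0 < r → v r < u (l₀ * r)) (hcoef : αl < l₀ ^ γ * αb) :
    ∀ᶠ l in 𝓝[<] l₀, ∀ r, 0 < r → v r ≤ u (l * r) := by
  have hl₀0 : 0 < l₀ := by linarith
  have hlγ : 0 < l₀ ^ γ := Real.rpow_pos_of_pos hl₀0 γ
  obtain ⟨a, ha, hab⟩ := exists_between hcoef
  obtain ⟨b, hb, hbα⟩ := exists_between (max_lt ((div_lt_iff₀' hlγ).2 hab) hα)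
  have hb0 : 0 < b := (le_max_right _ _).trans_lt hb
  have hab' : a < l₀ ^ γ * b := (div_lt_iff₀' hlγ).1 ((le_max_left _ _).trans_lt hb)
  obtain ⟨δ₁, hδ₁, hv⟩ := mem_nhdsGT_iff_exists_Ioo_subset.1
    (hv0.tendsto_div.eventually (gt_mem_nhds ha))
  obtain ⟨δ₂, hδ₂, hu⟩ := mem_nhdsGT_iff_exists_Ioo_subset.1
    (hu0.tendsto_div.eventually (lt_mem_nhds hbα))
  have hδ₁ : 0 < δ₁ := hδ₁
  have hδ₂ : 0 < δ₂ := hδ₂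
  obtain ⟨R, hR⟩ := eventually_atTop.1 (huinf.eventually (lt_mem_nhds hm))
  set δ := min δ₁ (δ₂ / l₀) with hδdef
  have hδ : 0 < δ := by positivity
  have hcpt : ∀ᶠ l in 𝓝 l₀, ∀ r ∈ Icc δ R, v r ≤ u (l * r) := by
    refine isCompact_Icc.eventually_forall_of_forall_eventually fun r hr => ?_
    have hr0 : 0 < r := hδ.trans_le hr.1
    have h1 : ContinuousAt (fun z : ℝ × ℝ => u (z.1 * z.2)) (l₀, r) :=
      ContinuousAt.comp (f := fun z : ℝ × ℝ => z.1 * z.2)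
        (huc.continuousAt (Ioi_mem_nhds (mul_pos hl₀0 hr0))) (by fun_prop)
    have h2 : ContinuousAt (fun z : ℝ × ℝ => v z.2) (l₀, r) :=
      ContinuousAt.comp (f := fun z : ℝ × ℝ => z.2)
        (hvc.continuousAt (Ioi_mem_nhds hr0)) (by fun_prop)
    exact (h2.eventually_lt h1 (hlt r hr0)).mono fun z hz => hz.le
  have hpow : ∀ᶠ l in 𝓝 l₀, a < l ^ γ * b :=
    ((Real.continuousAt_rpow_const l₀ γ (Or.inl hl₀0.ne')).mul_const b).eventually
      (lt_mem_nhds hab')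
  filter_upwards [nhdsWithin_le_nhds hcpt, nhdsWithin_le_nhds hpow,
    nhdsWithin_le_nhds (lt_mem_nhds hl₀), self_mem_nhdsWithin] with l hlc hlp hl1 hll r hr
  have hll : l < l₀ := hll
  have hl0 : 0 < l := by linarith
  rcases lt_or_ge r δ with h1 | h1
  · have hrγ : 0 < r ^ γ := Real.rpow_pos_of_pos hr γ
    have k1 : v r / r ^ γ < a := hv ⟨hr, h1.trans_le (min_le_left _ _)⟩
    have hlr : l * r < δ₂ := by
      have := (lt_div_iff₀' hl₀0).1 (h1.trans_le (min_le_right _ _))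
      exact (mul_lt_mul_of_pos_right hll hr).trans this
    have k2 : b < u (l * r) / (l * r) ^ γ := hu ⟨mul_pos hl0 hr, hlr⟩
    rw [div_lt_iff₀ hrγ] at k1
    rw [lt_div_iff₀ (Real.rpow_pos_of_pos (mul_pos hl0 hr) γ), Real.mul_rpow hl0.le hr.le] at k2
    nlinarith [mul_lt_mul_of_pos_right hlp hrγ]
  rcases le_or_gt r R with h2 | h2
  · exact hlc r ⟨h1, h2⟩
  · exact (hvm r hr).trans (hR _ (h2.le.trans (le_mul_of_one_le_left hr.le hl1.le))).le

/-- variant of the comparison principle where the asymptotics of `u̲` at `∞`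
is replaced by `limsup_{r→∞} u̲(r) < s₊`. -/
theorem stmt6 (p q sp : ℝ) (hp : 0 ≤ p) (hq : 0 < q) (hsp : 0 < sp)
    (F : ℝ → ℝ) (hF : CondF F sp)
    (ub lb : ℝ → ℝ) (αb αl βb : ℝ)
    (hsuper : IsSuperSolutionOn p q F (Set.Ioi 0) ub)
    (hsub : IsSubSolutionOn p q F (Set.Ioi 0) lb)
    (hubnd : ∀ r ∈ Set.Ioi (0:ℝ), 0 ≤ ub r ∧ ub r ≤ sp)
    (hlbnd : ∀ r ∈ Set.Ioi (0:ℝ), 0 ≤ lb r ∧ lb r ≤ sp)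
    (hαb : 0 < αb)
    (h0ub : AsympZero ub αb (gammaPlus p q))
    (h0lb : AsympZero lb αl (gammaPlus p q))
    (hiub : AsympInfty ub sp βb)
    (hlimsup : Filter.limsup lb Filter.atTop < sp) :
    (∀ r : ℝ, 0 < r → lb r ≤ ub r) ∧
      (∀ r₀ : ℝ, 0 < r₀ → ub r₀ = lb r₀ → ∀ r : ℝ, 0 < r → ub r = lb r) := by
  have hγ : 0 < gammaPlus p q := gammaPlus_pos hq
  have hupos : ∀ r, 0 < r → 0 < ub r := fun r hr =>
    hsuper.pos hp hq hF hubnd hαb h0ub hr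
  have hlt : ∀ r, 0 < r → lb r < sp := fun r hr => hsub.lt hq hsp hF hlbnd hr
  obtain ⟨m, hm, hlm⟩ := hsub.exists_le_lt hq hsp hF hlbnd h0lb hlimsup
  have hinf := hiub.tendsto
  have huc := hsuper.1.continuousOn
  have hlc := hsub.1.continuousOn
  obtain ⟨K, hK, hFK⟩ := hF.exists_lipschitz
  have hdiff : ∀ l, 1 ≤ l → (∀ r, 0 < r → lb r ≤ ub (l * r)) → ∀ x, 0 < x →
      SuperAt p (fun y => ub (l * y) - lb y) x ((q / x ^ 2 + K) * (ub (l * x) - lb x)) := by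
    intro l hl hle x hx
    have hl0 : 0 < l := by linarith
    have hb := hubnd (l * x) (mul_pos hl0 hx)
    refine (hsuper.superAt_comp_mul_sub hsub hl0 hx).mono ?_
    have h1 := hFK _ _ (hlbnd x hx).1 (hle x hx) hb.2
    have h2 : (l ^ 2 - 1) * F (ub (l * x)) ≤ 0 :=
      mul_nonpos_of_nonneg_of_nonpos (by nlinarith) (hF.nonpos hb.1 hb.2)
    linarith
  have hcont : ∀ l, 0 < l → ContinuousOn (fun y => ub (l * y) - lb y) (Ioi 0) := fun l hl =>
    (huc.comp (by fun_prop) fun y hy => mul_pos hl hy).sub hlc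
  set A : Set ℝ := {l | 1 ≤ l ∧ ∀ r, 0 < r → lb r ≤ ub (l * r)} with hA
  have hAne : A.Nonempty := exists_dilation_le hγ hm hsp.le hαb h0ub h0lb huc hupos hlm hinf
  have hAbdd : BddBelow A := ⟨1, fun l hl => hl.1⟩
  obtain ⟨l₀, hl₀⟩ : ∃ l₀, l₀ = sInf A := ⟨_, rfl⟩
  have hl₀A : l₀ ∈ A := by
    obtain ⟨s, -, hs, hsA⟩ := exists_seq_tendsto_sInf hAne hAbdd
    rw [← hl₀] at hs
    have h1 : 1 ≤ l₀ := ge_of_tendsto' hs fun n => (hsA n).1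
    refine ⟨h1, fun r hr => ?_⟩
    have hc : ContinuousAt ub (l₀ * r) := huc.continuousAt (Ioi_mem_nhds (by positivity))
    exact ge_of_tendsto' (hc.tendsto.comp (hs.mul_const r)) fun n => (hsA n).2 r hr
  obtain ⟨hl₀1, hle₀⟩ := hl₀A
  have hone : l₀ = 1 := by
    by_contra hne
    have h1 : 1 < l₀ := lt_of_le_of_ne hl₀1 (Ne.symm hne)
    have h0 : 0 < l₀ := by linarith
    have hstrict : ∀ r, 0 < r → lb r < ub (l₀ * r) := by
      intro r hr
      refine lt_of_le_of_ne (hle₀ r hr) fun he => ?_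
      have h := (hsuper.superAt_comp_mul_sub hsub h0 hr).nonneg_of_isLocalMin (by
        filter_upwards [Ioi_mem_nhds hr] with y hy
        rw [← he, sub_self]
        exact sub_nonneg.2 (hle₀ y hy))
      rw [← he, sub_self, mul_zero, zero_add] at h
      have hpos : 0 < lb r := by rw [he]; exact hupos _ (mul_pos h0 hr)
      have hneg : F (lb r) < 0 := hF.2.2.2.1 (lb r) ⟨hpos, hlt r hr⟩
      have hsq : 0 < l₀ ^ 2 - 1 := by nlinarith
      linarith [mul_neg_of_pos_of_neg hsq hneg]
    have hcoef : αl < l₀ ^ gammaPlus p q * αb := by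
      obtain ⟨c, hc, δ, hδ, hcw⟩ := exists_mul_rpow_le hp hq hK (hcont l₀ h0)
        (fun x hx => sub_pos.2 (hstrict x hx)) (hdiff l₀ hl₀1 hle₀)
      have hscale : Tendsto (fun r : ℝ => l₀ * r) (𝓝[>] 0) (𝓝[>] 0) := by
        refine tendsto_nhdsWithin_iff.2 ⟨?_, ?_⟩
        · have : Tendsto (fun r : ℝ => l₀ * r) (𝓝 0) (𝓝 (l₀ * 0)) :=
            (continuous_const.mul continuous_id).tendsto 0
          rw [mul_zero] at this
          exact this.mono_left nhdsWithin_le_nhds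
        · filter_upwards [self_mem_nhdsWithin] with r hr using mul_pos h0 hr
      have hlim := ((h0ub.tendsto_div.comp hscale).const_mul (l₀ ^ gammaPlus p q)).sub
        h0lb.tendsto_div
      have := ge_of_tendsto (b := c) hlim (by
        filter_upwards [Ioo_mem_nhdsGT hδ] with r hr
        have hr0 : 0 < r := hr.1
        have := hcw r hr
        have hrγ := Real.rpow_pos_of_pos hr0 (gammaPlus p q)
        have hlγ := Real.rpow_pos_of_pos h0 (gammaPlus p q)
        simp only [Function.comp_apply]
        rw [Real.mul_rpow h0.le hr0.le, ← mul_div_assoc, mul_div_mul_left _ _ hlγ.ne', ← sub_div,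
          le_div_iff₀ hrγ]
        exact this)
      linarith
    obtain ⟨l, hl, hl1, hll⟩ := ((eventually_dilation_le hm hαb h0ub h0lb huc hlc hlm hinf h1
      hstrict hcoef).and (Ioo_mem_nhdsLT h1)).exists
    exact absurd (csInf_le hAbdd (show l ∈ A from ⟨hl1.le, hl⟩)) (by rw [← hl₀]; exact not_le.2 hll)
  rw [hone] at hle₀
  refine ⟨fun r hr => by simpa using hle₀ r hr, fun r₀ hr₀ he r hr => ?_⟩
  have hz := eq_zero_of_superAt hp hq hK (hcont 1 one_pos)
    (fun x hx => sub_nonneg.2 (hle₀ x hx)) (hdiff 1 le_rfl hle₀) hr₀ (by simp [he]) r hr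
  simpa [sub_eq_zero] using hz
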